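/- arXiv:1205.5203 — 10 statements merged into one kernel-verified Lean document; each statement's English description precedes it below -/
import Mathlib

section
/- Let X be a topological space and let 𝒫 be the property of being empty (a space has 𝒫 if and only if it is empty). Then X is 𝒫-connected if and only if X is preconnected, i.e., X cannot be partitioned into two nonempty disjoint open subsets. -/
open Set Topology
open scoped unitInterval

universe u

/-- A zero-set of a topological space: the preimage of `{0}` under some continuous
function into `[0,1]`. -/
def IsZeroSetIn {X : Type u} [TopologicalSpace X] (Z : Set X) : Prop :=
  ∃ f : X → I, Continuous f ∧ Z = f ⁻¹' {0}

/-- A cozero-set: the complement of a zero-set. -/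
def IsCozeroSetIn {X : Type u} [TopologicalSpace X] (C : Set X) : Prop :=
  IsZeroSetIn Cᶜ

/-- A `P`-separation of `X`: disjoint cozero-sets `C`, `D` whose closures both fail `P`,
such that `X \ (C ∪ D)` is contained in a cozero-set whose closure has `P`. -/
def IsPSeparation (P : (Y : Type u) → [TopologicalSpace Y] → Prop)
    {X : Type u} [TopologicalSpace X] (C D : Set X) : Prop :=
  IsCozeroSetIn C ∧ IsCozeroSetIn D ∧ Disjoint C D ∧
    ¬ P ↥(closure C) ∧ ¬ P ↥(closure D) ∧
    ∃ E : Set X, IsCozeroSetIn E ∧ P ↥(closure E) ∧ (C ∪ D)ᶜ ⊆ E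

/-- `X` is `P`-connected if it admits no `P`-separation. -/
def PConnected (P : (Y : Type u) → [TopologicalSpace Y] → Prop)
    (X : Type u) [TopologicalSpace X] : Prop :=
  ¬ ∃ C D : Set X, IsPSeparation P C D

/-- `P` is closed hereditary. -/
def ClosedHereditary (P : (Y : Type u) → [TopologicalSpace Y] → Prop) : Prop :=
  ∀ (Y : Type u) [TopologicalSpace Y] (A : Set Y), IsClosed A → P Y → P ↥A

/-- `P` is preserved under finite sums of closed subspaces. -/
def PreservedByFiniteClosedSums (P : (Y : Type u) → [TopologicalSpace Y] → Prop) : Prop :=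
  ∀ (Y : Type u) [TopologicalSpace Y] (n : ℕ) (A : Fin n → Set Y),
    (∀ i, IsClosed (A i)) → (∀ i, P ↥(A i)) → (⋃ i, A i) = Set.univ → P Y

/-- `λ_P X ⊆ βX`. -/
def lambdaSet (P : (Y : Type u) → [TopologicalSpace Y] → Prop)
    (X : Type u) [TopologicalSpace X] : Set (StoneCech X) :=
  ⋃ C ∈ {C : Set X | IsCozeroSetIn C ∧ P ↥(closure C)},
    interior (closure (stoneCechUnit '' C))

/-- `Ex_X U = βX \ cl_βX (X \ U)`. -/
def ExSet {X : Type u} [TopologicalSpace X] (U : Set X) : Set (StoneCech X) :=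
  (closure (stoneCechUnit '' Uᶜ))ᶜ

/-- The Hewitt realcompactification `υX`, realized inside `βX`. -/
def upsilonSet (X : Type u) [TopologicalSpace X] : Set (StoneCech X) :=
  {p | ∀ Z : Set (StoneCech X), IsZeroSetIn Z → p ∈ Z →
    (Z ∩ Set.range (stoneCechUnit : X → StoneCech X)).Nonempty}

/-- A space is pseudocompact if every continuous real-valued function on it is bounded. -/
def Pseudocompact (Y : Type u) [TopologicalSpace Y] : Prop :=
  ∀ f : Y → ℝ, Continuous f → ∃ M : ℝ, ∀ y, |f y| ≤ M

/-- A perfect map: continuous, closed, with compact fibers. -/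
def IsPerfectMap {X Y : Type u} [TopologicalSpace X] [TopologicalSpace Y] (f : X → Y) : Prop :=
  Continuous f ∧ IsClosedMap f ∧ ∀ y : Y, IsCompact (f ⁻¹' {y})

theorem IsCozeroSetIn.isOpen {X : Type u} [TopologicalSpace X] {C : Set X}
    (hC : IsCozeroSetIn C) : IsOpen C := by
  obtain ⟨f, hf, hfC⟩ := hC
  rw [← isClosed_compl_iff, hfC]
  exact isClosed_singleton.preimage hf

theorem IsClopen.isCozeroSetIn {X : Type u} [TopologicalSpace X] {C : Set X}
    (hC : IsClopen C) : IsCozeroSetIn C := by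
  classical
  refine ⟨C.indicator fun _ => 1, continuous_const.indicator (by simp [hC.frontier_eq]), ?_⟩
  ext x
  by_cases hx : x ∈ C <;> simp [hx]

theorem isEmpty_closure_iff {X : Type u} [TopologicalSpace X] {s : Set X} :
    IsEmpty ↥(closure s) ↔ s = ∅ := by
  simp [isEmpty_coe_sort]

/-- A separation with respect to emptiness is a partition into two nonempty open sets. -/
theorem isPSeparation_isEmpty_iff {X : Type u} [TopologicalSpace X] {C D : Set X} :
    IsPSeparation (fun Y _ => IsEmpty Y) C D ↔ IsClopen C ∧ C ≠ ∅ ∧ C ≠ univ ∧ D = Cᶜ := by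
  simp only [IsPSeparation, isEmpty_closure_iff]
  constructor
  · rintro ⟨hC, hD, hCD, hC0, hD0, E, -, rfl, hE⟩
    have hDC : D = Cᶜ := by
      refine (compl_unique hCD.eq_bot ?_).symm
      exact compl_empty_iff.mp (subset_empty_iff.mp hE)
    subst hDC
    exact ⟨⟨⟨hD.isOpen⟩, hC.isOpen⟩, hC0, fun h => hD0 (compl_empty_iff.mpr h), rfl⟩
  · rintro ⟨hC, hC0, hC1, rfl⟩
    exact ⟨hC.isCozeroSetIn, hC.compl.isCozeroSetIn, disjoint_compl_right, hC0,
      fun h => hC1 (compl_empty_iff.mp h), ∅, isClopen_empty.isCozeroSetIn, rfl, by simp⟩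

/-- With `𝒫` = "being empty", `𝒫`-connectedness coincides with usual (pre)connectedness. -/
theorem emptyProperty_connected_iff_preconnectedSpace (X : Type u) [TopologicalSpace X] :
    PConnected (fun Y _ => IsEmpty Y) X ↔ PreconnectedSpace X := by
  simp only [PConnected, isPSeparation_isEmpty_iff, preconnectedSpace_iff_clopen]
  constructor
  · intro h s hs
    by_contra! hne
    exact h ⟨s, sᶜ, hs, by simpa [nonempty_iff_ne_empty] using hne.1, hne.2, rfl⟩
  · rintro h ⟨C, _, hC, hC0, hC1, -⟩
    exact (h C hC).elim hC0 hC1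
end

section
/- Let X be a Tychonoff space and let 𝒫 be a topological property. Suppose Z ⊆ C, where Z is a zero-set of X, C is a cozero-set of X, and cl_X C has 𝒫. Then cl_βX Z ⊆ λ_𝒫X. -/
open Set Topology
open scoped unitInterval

universe u

/-- A zero-set and a cozero-set containing it are separated by a continuous function
that vanishes on the former and equals `1` outside the latter. -/
theorem IsZeroSetIn.exists_continuous_zero_one {X : Type u} [TopologicalSpace X] {Z C : Set X}
    (hZ : IsZeroSetIn Z) (hC : IsCozeroSetIn C) (hZC : Z ⊆ C) :
    ∃ h : X → I, Continuous h ∧ (∀ x ∈ Z, h x = 0) ∧ ∀ x ∉ C, h x = 1 := by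
  obtain ⟨f, hf, rfl⟩ := hZ
  obtain ⟨g, hg, hgC⟩ := hC
  have hpos : ∀ x, 0 < (f x : ℝ) + g x := by
    intro x
    by_cases hx : x ∈ C
    · have hne : g x ≠ 0 := fun h0 ↦ (hgC.symm.subset (show x ∈ g ⁻¹' {0} from h0)) hx
      exact add_pos_of_nonneg_of_pos (f x).2.1 (unitInterval.pos_iff_ne_zero.2 hne)
    · have hne : f x ≠ 0 := fun h0 ↦ hx (hZC h0)
      exact add_pos_of_pos_of_nonneg (unitInterval.pos_iff_ne_zero.2 hne) (g x).2.1
  refine ⟨fun x ↦ ⟨(f x : ℝ) / (f x + g x), div_nonneg (f x).2.1 (hpos x).le,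
    (div_le_one (hpos x)).2 (le_add_of_nonneg_right (g x).2.1)⟩, ?_, ?_, ?_⟩
  · refine Continuous.subtype_mk (Continuous.div ?_ ?_ fun x ↦ (hpos x).ne') _ <;> fun_prop
  · intro x (hx : f x = 0)
    ext
    simp [hx]
  · intro x hx
    have hgx : g x = 0 := hgC.subset hx
    have hfx := hpos x
    ext
    simp only [hgx, Set.Icc.coe_zero, add_zero, Set.Icc.coe_one] at hfx ⊢
    exact div_self hfx.ne'

/-- The closure in `βX` of a zero-set contained in a cozero-set `C` lies in the interior of the
closure of `C`. -/
theorem IsZeroSetIn.closure_stoneCechUnit_subset_interior {X : Type u} [TopologicalSpace X]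
    {Z C : Set X} (hZ : IsZeroSetIn Z) (hC : IsCozeroSetIn C) (hZC : Z ⊆ C) :
    closure (stoneCechUnit '' Z) ⊆ interior (closure (stoneCechUnit '' C)) := by
  obtain ⟨h, hcont, h_zero, h_one⟩ := hZ.exists_continuous_zero_one hC hZC
  have hext := continuous_stoneCechExtend hcont
  have hopen : IsOpen (stoneCechExtend hcont ⁻¹' {1}ᶜ) := isOpen_compl_singleton.preimage hext
  have hsub : closure (stoneCechUnit '' Z) ⊆ stoneCechExtend hcont ⁻¹' {0} := by
    refine closure_minimal ?_ (isClosed_singleton.preimage hext)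
    rintro _ ⟨x, hx, rfl⟩
    simp [stoneCechExtend_stoneCechUnit, h_zero x hx]
  refine hsub.trans (Subset.trans ?_ (interior_maximal ?_ hopen))
  · exact preimage_mono (by simp)
  · refine (denseRange_stoneCechUnit.open_subset_closure_inter hopen).trans (closure_mono ?_)
    rintro _ ⟨hx, x, rfl⟩
    refine mem_image_of_mem _ (by_contra fun hxC ↦ hx ?_)
    simp [stoneCechExtend_stoneCechUnit, h_one x hxC]

/-- If `Z ⊆ C` with `Z` a zero-set, `C` a cozero-set and `cl_X C` having `𝒫`, then
`cl_βX Z ⊆ λ_𝒫X`. -/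
theorem stoneCechClosure_zeroSet_subset_lambdaSet
    (X : Type u) [TopologicalSpace X] [T35Space X]
    (P : (Y : Type u) → [TopologicalSpace Y] → Prop)
    (Z C : Set X) (hZ : IsZeroSetIn Z) (hC : IsCozeroSetIn C)
    (hZC : Z ⊆ C) (hPC : P ↥(closure C)) :
    closure (stoneCechUnit '' Z) ⊆ lambdaSet P X := by
  exact (hZ.closure_stoneCechUnit_subset_interior hC hZC).trans
    (subset_biUnion_of_mem (u := fun C ↦ interior (closure (stoneCechUnit '' C))) ⟨hC, hPC⟩)
end

section
/- (Skljarenko; van Douwen) Let X be a Tychonoff space and let U be an open subset of X. Then the boundary in βX of Ex_X U equals the closure in βX of the boundary of U in X: bd_βX(Ex_X U) = cl_βX(bd_X U). -/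
open Set Topology
open scoped unitInterval

universe u

/-- The closure in `βX` of `Ex_X U` is the closure of `U`. -/
lemma closure_exSet {X : Type u} [TopologicalSpace X] [T35Space X] {U : Set X} (hU : IsOpen U) :
    closure (ExSet U) = closure (stoneCechUnit '' U) := by
  apply subset_antisymm
  · have hopen : IsOpen (ExSet U) := isClosed_closure.isOpen_compl
    refine closure_minimal ((denseRange_stoneCechUnit.open_subset_closure_inter hopen).trans
      (closure_mono ?_)) isClosed_closure
    rintro _ ⟨hx, x, rfl⟩
    refine mem_image_of_mem _ ?_
    by_contra hxU
    exact hx (subset_closure (mem_image_of_mem _ hxU))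
  · refine closure_mono ?_
    rintro _ ⟨x, hx, rfl⟩ hmem
    have hcl := isEmbedding_stoneCechUnit.isInducing.closure_eq_preimage_closure_image Uᶜ
    rw [hU.isClosed_compl.closure_eq] at hcl
    exact hcl.ge hmem hx

/-- Any point of `βX` lying in the closures of both a set and its complement lies in the closure
of the frontier of that set. -/
lemma closure_image_inter_closure_image_compl_subset {X : Type u} [TopologicalSpace X]
    (U : Set X) :
    closure (stoneCechUnit '' U) ∩ closure (stoneCechUnit '' Uᶜ) ⊆
      closure (stoneCechUnit '' frontier U) := by
  classical
  rintro p ⟨hpU, hpUc⟩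
  by_contra hp
  obtain ⟨f, hf, hfp, hf1⟩ :=
    CompletelyRegularSpace.completely_regular p _ isClosed_closure hp
  have hg : Continuous (U.piecewise (f ∘ stoneCechUnit) (fun _ => (1 : I))) :=
    Continuous.piecewise (fun x hx => hf1 (subset_closure (mem_image_of_mem _ hx)))
      (hf.comp continuous_stoneCechUnit) continuous_const
  have hG := continuous_stoneCechExtend hg
  have h0 : stoneCechExtend hg p = f p := by
    refine closure_minimal ?_ (isClosed_eq hG hf) hpU
    rintro _ ⟨x, hx, rfl⟩
    simp [stoneCechExtend_stoneCechUnit, hx]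
  have h1 : stoneCechExtend hg p = 1 := by
    refine closure_minimal ?_ (isClosed_eq hG continuous_const) hpUc
    rintro _ ⟨x, hx, rfl⟩
    rw [mem_ofPred_eq, stoneCechExtend_stoneCechUnit, piecewise_eq_of_notMem _ _ _ hx]
  exact zero_ne_one (hfp.symm.trans (h0.symm.trans h1))

/-- (Skljarenko; van Douwen) `bd_βX (Ex_X U) = cl_βX (bd_X U)` for open `U ⊆ X`. -/
theorem frontier_exSet_eq_closure_image_frontier
    (X : Type u) [TopologicalSpace X] [T35Space X]
    (U : Set X) (hU : IsOpen U) :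
    frontier (ExSet U) = closure (stoneCechUnit '' frontier U) := by
  have hfrontier : frontier (ExSet U) =
      closure (stoneCechUnit '' U) ∩ closure (stoneCechUnit '' Uᶜ) := by
    rw [frontier_eq_closure_inter_closure, closure_exSet hU, ExSet, compl_compl, closure_closure]
  rw [hfrontier]
  refine (closure_image_inter_closure_image_compl_subset U).antisymm
    (closure_minimal ?_ (isClosed_closure.inter isClosed_closure))
  rintro _ ⟨x, hx, rfl⟩
  rw [frontier_eq_closure_inter_closure] at hx
  have hmap (S : Set X) := image_closure_subset_closure_image (s := S) continuous_stoneCechUnit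
  exact ⟨hmap U (mem_image_of_mem _ hx.1), hmap Uᶜ (mem_image_of_mem _ hx.2)⟩
end

section
/- Let X be a Tychonoff space and let 𝒫 be a topological property. Let U be an open subset of X such that bd_X U ⊆ Z ⊆ C, where Z is a zero-set of X, C is a cozero-set of X, and cl_X C has 𝒫. Then cl_βX U \ λ_𝒫X = Ex_X U \ λ_𝒫X. -/
open Set Topology
open scoped unitInterval

universe u

/-- Disjoint zero-sets are completely separated. -/
theorem exists_continuous_unitInterval_of_disjoint_zeroSets {X : Type u} [TopologicalSpace X]
    {A B : Set X} (hA : IsZeroSetIn A) (hB : IsZeroSetIn B) (hAB : Disjoint A B) :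
    ∃ h : X → I, Continuous h ∧ (∀ x ∈ A, h x = 0) ∧ ∀ x ∈ B, h x = 1 := by
  obtain ⟨f, hf, rfl⟩ := hA
  obtain ⟨g, hg, rfl⟩ := hB
  have hpos (x : X) : 0 < (f x : ℝ) + g x := by
    refine (add_nonneg (f x).2.1 (g x).2.1).lt_of_ne' fun hx ↦ ?_
    obtain ⟨h₁, h₂⟩ := (add_eq_zero_iff_of_nonneg (f x).2.1 (g x).2.1).1 hx
    exact disjoint_left.1 hAB (show f x = 0 from Subtype.ext h₁) (Subtype.ext h₂)
  refine ⟨fun x ↦ ⟨f x / (f x + g x), div_nonneg (f x).2.1 (hpos x).le,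
    (div_le_one (hpos x)).2 (le_add_of_nonneg_right (g x).2.1)⟩, ?_, fun x hx ↦ ?_, fun x hx ↦ ?_⟩
  · exact Continuous.subtype_mk
      ((by fun_prop : Continuous fun x ↦ (f x : ℝ)).div (by fun_prop) fun x ↦ (hpos x).ne') _
  · have hx : f x = 0 := hx
    ext
    simp [hx]
  · have hx : g x = 0 := hx
    have := hpos x
    ext
    simp only [hx, Icc.coe_zero, add_zero, Icc.coe_one] at this ⊢
    exact div_self this.ne'

theorem stoneCechExtend_eqOn_closure_image {X Y : Type*} [TopologicalSpace X]
    [TopologicalSpace Y] [T2Space Y] [CompactSpace Y] {f g : X → Y} (hf : Continuous f)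
    (hg : Continuous g) {A : Set X} (h : EqOn f g A) :
    EqOn (stoneCechExtend hf) (stoneCechExtend hg) (closure (stoneCechUnit '' A)) := by
  refine EqOn.closure ?_ (continuous_stoneCechExtend hf) (continuous_stoneCechExtend hg)
  rintro _ ⟨x, hx, rfl⟩
  simpa only [stoneCechExtend_stoneCechUnit] using h hx

theorem IsOpen.subset_interior_closure_image_stoneCechUnit {X : Type*} [TopologicalSpace X]
    {O : Set (StoneCech X)} (hO : IsOpen O) {C : Set X} (h : stoneCechUnit ⁻¹' O ⊆ C) :
    O ⊆ interior (closure (stoneCechUnit '' C)) := by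
  refine interior_maximal ((denseRange_stoneCechUnit.open_subset_closure_inter hO).trans
    (closure_mono ?_)) hO
  rintro _ ⟨hx, x, rfl⟩
  exact mem_image_of_mem _ (h hx)

theorem exSet_subset_closure {X : Type u} [TopologicalSpace X] (U : Set X) :
    ExSet U ⊆ closure (stoneCechUnit '' U) := by
  have h : closure (stoneCechUnit '' U) ∪ closure (stoneCechUnit '' Uᶜ) = univ := by
    rw [← closure_union, ← image_union, union_compl_self, image_univ]
    exact denseRange_stoneCechUnit.closure_range
  exact fun p hp ↦ (h.ge (mem_univ p)).resolve_right hp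

/-- If `bd_X U ⊆ Z ⊆ C` with `Z` a zero-set, `C` a cozero-set and `cl_X C` having `𝒫`,
then `cl_βX U \ λ_𝒫X = Ex_X U \ λ_𝒫X`. -/
theorem closure_diff_lambdaSet_eq_exSet_diff_lambdaSet
    (X : Type u) [TopologicalSpace X] [T35Space X]
    (P : (Y : Type u) → [TopologicalSpace Y] → Prop)
    (U Z C : Set X) (hU : IsOpen U) (hZ : IsZeroSetIn Z) (hC : IsCozeroSetIn C)
    (hUZ : frontier U ⊆ Z) (hZC : Z ⊆ C) (hPC : P ↥(closure C)) :
    closure (stoneCechUnit '' U) \ lambdaSet P X = ExSet U \ lambdaSet P X := by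
  classical
  refine Subset.antisymm (fun p ⟨hpU, hpl⟩ ↦ ⟨fun hpUc ↦ hpl ?_, hpl⟩)
    (sdiff_subset_sdiff_left (exSet_subset_closure U))
  obtain ⟨h, hh, h0, h1⟩ := exists_continuous_unitInterval_of_disjoint_zeroSets hZ hC
    (disjoint_compl_right_iff_subset.2 hZC)
  have hk : Continuous (U.piecewise h fun _ ↦ 0) :=
    hh.piecewise (fun x hx ↦ h0 x (hUZ hx)) continuous_const
  have hp : stoneCechExtend hh p = stoneCechExtend (continuous_const (y := (0 : I))) p :=
    (stoneCechExtend_eqOn_closure_image hk hh (piecewise_eqOn U h _) hpU).symm.trans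
      (stoneCechExtend_eqOn_closure_image hk continuous_const (piecewise_eqOn_compl U h _) hpUc)
  have hconst : stoneCechExtend (continuous_const (X := X) (y := (0 : I))) = fun _ ↦ 0 :=
    stoneCech_hom_ext (continuous_stoneCechExtend _) continuous_const
      (stoneCechExtend_extends _)
  rw [hconst] at hp
  refine mem_biUnion (show C ∈ {C : Set X | IsCozeroSetIn C ∧ P ↥(closure C)} from ⟨hC, hPC⟩)
    (IsOpen.subset_interior_closure_image_stoneCechUnit
      (isOpen_ne (x := 1) |>.preimage (continuous_stoneCechExtend hh))
      (fun x hx ↦ ?_) (show stoneCechExtend hh p ≠ 1 by simp [hp]))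
  by_contra hxC
  exact hx (by rw [stoneCechExtend_stoneCechUnit, h1 x hxC])
end

section
/- Let X be a locally compact Hausdorff space and let 𝒫 be compactness. Then X is 𝒫-connected if and only if the remainder βX \ X is a preconnected subset of βX. -/
open Set Topology
open scoped unitInterval

universe u

theorem isCozeroSetIn_setOf_pos {X : Type u} [TopologicalSpace X] {f : X → ℝ}
    (hf : Continuous f) : IsCozeroSetIn {x | 0 < f x} := by
  refine ⟨fun x => projIcc 0 1 zero_le_one (f x), continuous_projIcc.comp hf, ?_⟩
  ext x
  simp

theorem IsCozeroSetIn.exists_continuous_pos_iff {X : Type u} [TopologicalSpace X] {C : Set X}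
    (hC : IsCozeroSetIn C) :
    ∃ f : X → ℝ, Continuous f ∧ (∀ x, 0 ≤ f x) ∧ ∀ x, 0 < f x ↔ x ∈ C := by
  obtain ⟨f, hf, hCf⟩ := hC
  refine ⟨fun x => f x, continuous_subtype_val.comp hf, fun x => (f x).2.1, fun x => ?_⟩
  have hx : x ∉ C ↔ f x = 0 := by
    rw [← mem_compl_iff, hCf]
    rfl
  rw [← not_iff_not, hx, not_lt, ← Subtype.coe_inj]
  exact ⟨fun h => le_antisymm h (f x).2.1, fun h => h.le⟩

theorem t35Space_of_locallyCompactSpace (X : Type u) [TopologicalSpace X] [T2Space X]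
    [LocallyCompactSpace X] : T35Space X := by
  have : CompletelyRegularSpace X := by
    refine ⟨fun x K hK hx => ?_⟩
    obtain ⟨f, hf0, hf1, hf⟩ := exists_continuous_zero_one_of_isCompact
      (isCompact_singleton (x := x)) hK (disjoint_singleton_left.2 hx)
    refine ⟨fun y => ⟨f y, hf y⟩, by fun_prop, Subtype.ext (hf0 rfl), fun y hy => ?_⟩
    exact Subtype.ext (hf1 hy)
  exact {}

theorem Topology.IsDenseInducing.isOpen_range {X Y : Type*} [TopologicalSpace X]
    [LocallyCompactSpace X] [TopologicalSpace Y] [T2Space Y] {e : X → Y}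
    (he : IsDenseInducing e) : IsOpen (range e) := by
  rw [isOpen_iff_mem_nhds]
  rintro _ ⟨x, rfl⟩
  obtain ⟨L, hL, hxL⟩ := exists_compact_mem_nhds x
  rw [he.toIsInducing.nhds_eq_comap, Filter.mem_comap] at hxL
  obtain ⟨V, hV, hVL⟩ := hxL
  obtain ⟨U, hUV, hU, hxU⟩ := mem_nhds_iff.1 hV
  refine Filter.mem_of_superset (hU.mem_nhds hxU) ?_
  have hUL : U ∩ range e ⊆ e '' L := by
    rintro _ ⟨hy, y, rfl⟩
    exact ⟨y, hVL (hUV hy), rfl⟩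
  exact (he.dense.open_subset_closure_inter hU).trans
    ((closure_minimal hUL (hL.image he.continuous).isClosed).trans (image_subset_range _ _))

theorem Topology.IsInducing.isCompact_closure_iff {X Y : Type*} [TopologicalSpace X]
    [TopologicalSpace Y] [CompactSpace Y] [T2Space Y] {e : X → Y} (he : IsInducing e) {A : Set X} :
    IsCompact (closure A) ↔ closure (e '' A) ⊆ range e := by
  constructor
  · intro h
    exact (closure_minimal (image_mono subset_closure)
      (h.image he.continuous).isClosed).trans (image_subset_range _ _)
  · intro h
    rw [he.closure_eq_preimage_closure_image]
    exact he.isCompact_preimage' isClosed_closure.isCompact h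

/-- If two disjoint closed sets cover the remainder of a compactification and both meet it, the
dense subspace has a separation with respect to compactness. -/
theorem exists_isPSeparation_of_closed_cover {X : Type u} {Y : Type*} [TopologicalSpace X]
    [T2Space X] [LocallyCompactSpace X] [TopologicalSpace Y] [CompactSpace Y] [T2Space Y]
    {e : X → Y} (he : IsDenseInducing e) {A B : Set Y} (hA : IsClosed A) (hB : IsClosed B)
    (hAB : Disjoint A B) (hcover : (range e)ᶜ ⊆ A ∪ B)
    (hA' : ((range e)ᶜ ∩ A).Nonempty) (hB' : ((range e)ᶜ ∩ B).Nonempty) :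
    ∃ C D : Set X, IsPSeparation (fun Z _ => CompactSpace Z) C D := by
  obtain ⟨f, hf0, hf1, -⟩ := exists_continuous_zero_one_of_isClosed hA hB hAB
  have hfe : Continuous fun x => f (e x) := f.continuous.comp he.continuous
  have not_compact : ∀ U : Set Y, IsOpen U → ((range e)ᶜ ∩ U).Nonempty →
      ¬ CompactSpace (closure (e ⁻¹' U)) := by
    rintro U hU ⟨p, hp, hpU⟩ hcompact
    rw [← isCompact_iff_compactSpace, he.toIsInducing.isCompact_closure_iff,
      image_preimage_eq_inter_range] at hcompact
    exact hp (hcompact (he.dense.open_subset_closure_inter hU hpU))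
  have hK : IsCompact (e ⁻¹' (f ⁻¹' Icc (1 / 3) (2 / 3))) := by
    refine he.toIsInducing.isCompact_preimage'
      (isClosed_Icc.preimage f.continuous).isCompact fun y hy => ?_
    by_contra hyr
    rw [mem_preimage, mem_Icc] at hy
    rcases hcover hyr with h | h
    · have := hf0 h
      norm_num [this] at hy
    · have := hf1 h
      norm_num [this] at hy
  obtain ⟨g, hgK, -, hg, -⟩ := exists_continuous_one_zero_of_isCompact hK isClosed_empty
    (disjoint_empty _)
  refine ⟨e ⁻¹' (f ⁻¹' Iio (1 / 3)), e ⁻¹' (f ⁻¹' Ioi (2 / 3)), ?_, ?_, ?_, ?_, ?_,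
    {x | 0 < g x}, isCozeroSetIn_setOf_pos g.continuous, ?_, ?_⟩
  · have h := isCozeroSetIn_setOf_pos (f := fun x => 1 / 3 - f (e x)) (continuous_const.sub hfe)
    simp only [sub_pos] at h
    exact h
  · have h := isCozeroSetIn_setOf_pos (f := fun x => f (e x) - 2 / 3) (hfe.sub continuous_const)
    simp only [sub_pos] at h
    exact h
  · refine ((Iio_disjoint_Ioi_of_le ?_).preimage f).preimage e
    norm_num
  · obtain ⟨p, hp, hpA⟩ := hA'
    refine not_compact _ (isOpen_Iio.preimage f.continuous) ⟨p, hp, ?_⟩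
    simp [hf0 hpA]
  · obtain ⟨p, hp, hpB⟩ := hB'
    refine not_compact _ (isOpen_Ioi.preimage f.continuous) ⟨p, hp, ?_⟩
    have := hf1 hpB
    norm_num [this]
  · refine isCompact_iff_compactSpace.1 (hg.isCompact.of_isClosed_subset isClosed_closure
      (closure_mono fun x hx => ne_of_gt hx))
  · intro x hx
    have hx1 : g x = 1 := hgK <| by
      simpa only [mem_compl_iff, mem_union, mem_preimage, mem_Iio, mem_Ioi, mem_Icc, not_or, not_lt]
        using hx
    simp [hx1]

/-- Two disjoint cozero-sets which together with a third one cover `X` have closures in `βX`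
meeting only inside the closure of the third. -/
theorem closure_inter_closure_subset_of_cover {X : Type u} [TopologicalSpace X] {C D E : Set X}
    (hC : IsCozeroSetIn C) (hD : IsCozeroSetIn D) (hE : IsCozeroSetIn E) (hCD : Disjoint C D)
    (hcover : (C ∪ D)ᶜ ⊆ E) :
    closure ((stoneCechUnit : X → StoneCech X) '' C) ∩ closure (stoneCechUnit '' D) ⊆
      closure (stoneCechUnit '' E) := by
  obtain ⟨c, hc, hc0, hcC⟩ := hC.exists_continuous_pos_iff
  obtain ⟨d, hd, hd0, hdD⟩ := hD.exists_continuous_pos_iff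
  obtain ⟨a, ha, ha0, haE⟩ := hE.exists_continuous_pos_iff
  have hpos : ∀ x, 0 < (d x + a x) + (c x + a x) := by
    intro x
    by_cases hx : x ∈ C ∪ D
    · rcases hx with hx | hx
      · linarith [(hcC x).2 hx, hd0 x, ha0 x]
      · linarith [(hdD x).2 hx, hc0 x, ha0 x]
    · linarith [(haE x).2 (hcover hx), hc0 x, hd0 x]
  let h : X → I := fun x => ⟨(d x + a x) / ((d x + a x) + (c x + a x)),
    div_nonneg (add_nonneg (hd0 x) (ha0 x)) (hpos x).le,
    (div_le_one (hpos x)).2 (by linarith [hc0 x, ha0 x])⟩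
  have hh : Continuous h :=
    ((hd.add ha).div ((hd.add ha).add (hc.add ha)) fun x => (hpos x).ne').subtype_mk _
  have h0 : ∀ x ∈ C \ E, h x = 0 := by
    rintro x ⟨hxC, hxE⟩
    have h1 : d x = 0 :=
      le_antisymm (not_lt.1 fun hx => hCD.notMem_of_mem_left hxC ((hdD x).1 hx)) (hd0 x)
    have h2 : a x = 0 := le_antisymm (not_lt.1 fun hx => hxE ((haE x).1 hx)) (ha0 x)
    exact Subtype.ext (by simp [h, h1, h2])
  have h1 : ∀ x ∈ D \ E, h x = 1 := by
    rintro x ⟨hxD, hxE⟩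
    have h1 : c x = 0 :=
      le_antisymm (not_lt.1 fun hx => hCD.notMem_of_mem_left ((hcC x).1 hx) hxD) (hc0 x)
    have h2 : a x = 0 := le_antisymm (not_lt.1 fun hx => hxE ((haE x).1 hx)) (ha0 x)
    exact Subtype.ext (by simp [h, h1, h2, ((hdD x).2 hxD).ne'])
  have extend_eq : ∀ (S : Set X) (t : I), (∀ x ∈ S \ E, h x = t) →
      closure (stoneCechUnit '' S) ⊆
        closure (stoneCechUnit '' E) ∪ stoneCechExtend hh ⁻¹' {t} := by
    intro S t ht
    refine closure_minimal ?_ (isClosed_closure.union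
      (isClosed_singleton.preimage (continuous_stoneCechExtend hh)))
    rintro _ ⟨x, hx, rfl⟩
    by_cases hxE : x ∈ E
    · exact Or.inl (subset_closure (mem_image_of_mem _ hxE))
    · right
      simpa using ht x ⟨hx, hxE⟩
  rintro p ⟨hpC, hpD⟩
  rcases extend_eq C 0 h0 hpC with hp | hp
  · exact hp
  rcases extend_eq D 1 h1 hpD with hp' | hp'
  · exact hp'
  exact absurd (hp.symm.trans hp') zero_ne_one

/-- For locally compact Hausdorff `X` and `𝒫` = compactness, `X` is `𝒫`-connected
iff the remainder `βX \ X` is preconnected. -/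
theorem compactness_connected_iff_isPreconnected_remainder
    (X : Type u) [TopologicalSpace X] [T2Space X] [LocallyCompactSpace X] :
    PConnected (fun Y _ => CompactSpace Y) X ↔
      IsPreconnected ((Set.range (stoneCechUnit : X → StoneCech X))ᶜ) := by
  have := t35Space_of_locallyCompactSpace X
  have he : IsDenseInducing (stoneCechUnit : X → StoneCech X) := isDenseInducing_stoneCechUnit
  constructor
  · intro hX
    rw [isPreconnected_closed_iff]
    intro A B hA hB hcover hA' hB'
    by_contra hAB
    rw [not_nonempty_iff_eq_empty] at hAB
    have hR : IsClosed (range (stoneCechUnit : X → StoneCech X))ᶜ := he.isOpen_range.isClosed_compl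
    refine hX (exists_isPSeparation_of_closed_cover he (hR.inter hA) (hR.inter hB) ?_ ?_ ?_ ?_)
    · rw [disjoint_iff_inter_eq_empty, ← inter_inter_distrib_left, hAB]
    · rw [← inter_union_distrib_left]
      exact subset_inter Subset.rfl hcover
    · rwa [← inter_assoc, inter_self]
    · rwa [← inter_assoc, inter_self]
  · rintro hR ⟨C, D, hC, hD, hCD, hCc, hDc, E, hE, hEc, hcover⟩
    beta_reduce at hCc hDc hEc
    rw [← isCompact_iff_compactSpace, he.toIsInducing.isCompact_closure_iff] at hCc hDc hEc
    have hbeta : closure ((stoneCechUnit : X → StoneCech X) '' C) ∪ closure (stoneCechUnit '' D) ∪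
        closure (stoneCechUnit '' E) = univ := by
      rw [← closure_union, ← closure_union, ← image_union, ← image_union,
        compl_subset_iff_union.1 hcover, image_univ, he.dense.closure_range]
    obtain ⟨p, hpR, hp⟩ := isPreconnected_closed_iff.1 hR _ _
      (isClosed_closure (s := stoneCechUnit '' C)) (isClosed_closure (s := stoneCechUnit '' D))
      (fun p hp => (hbeta.symm.subset (mem_univ p)).resolve_right fun h => hp (hEc h))
      ((not_subset.1 hCc).imp fun p hp => hp.symm) ((not_subset.1 hDc).imp fun p hp => hp.symm)
    exact hpR (hEc (closure_inter_closure_subset_of_cover hC hD hE hCD hcover hp))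
end

section
/- Let 𝒫 be a closed hereditary topological property that is both invariant and inverse invariant under perfect continuous surjections. If f : X → Y is a perfect continuous surjection of topological spaces and X is 𝒫-connected, then Y is 𝒫-connected. -/
open Set Topology
open scoped unitInterval

universe u

theorem IsCozeroSetIn.preimage {X Y : Type u} [TopologicalSpace X] [TopologicalSpace Y]
    {f : X → Y} (hf : Continuous f) {C : Set Y} (hC : IsCozeroSetIn C) :
    IsCozeroSetIn (f ⁻¹' C) := by
  obtain ⟨g, hg, hCg⟩ := hC
  exact ⟨g ∘ f, hg.comp hf, by rw [← preimage_compl, hCg, preimage_comp]⟩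

theorem IsPerfectMap.restrict {X Y : Type u} [TopologicalSpace X] [TopologicalSpace Y]
    {f : X → Y} (hf : IsPerfectMap f) {A : Set X} {B : Set Y} (hA : IsClosed A)
    (h : MapsTo f A B) : IsPerfectMap (h.restrict f A B) := by
  obtain ⟨hcont, hclosed, hfiber⟩ := hf
  refine ⟨hcont.restrict h, ?_, fun y => ?_⟩
  · exact (hclosed.comp hA.isClosedMap_subtype_val).codRestrict fun x => h x.2
  · have hpre : h.restrict f A B ⁻¹' {y} = Subtype.val ⁻¹' (f ⁻¹' {(y : Y)}) := by
      ext x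
      simp [Subtype.ext_iff]
    rw [hpre]
    exact hA.isClosedEmbedding_subtypeVal.isCompact_preimage (hfiber y)

/-- A perfect surjection restricts to a perfect surjection from the closure of the preimage
of a set onto the closure of that set. -/
theorem IsPerfectMap.exists_closure_preimage {X Y : Type u} [TopologicalSpace X]
    [TopologicalSpace Y] {f : X → Y} (hf : IsPerfectMap f) (hfs : Function.Surjective f)
    (C : Set Y) :
    ∃ g : closure (f ⁻¹' C) → closure C, IsPerfectMap g ∧ Function.Surjective g := by
  have hmaps : MapsTo f (closure (f ⁻¹' C)) (closure C) :=
    (mapsTo_preimage f C).closure hf.1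
  refine ⟨hmaps.restrict f _ _, hf.restrict isClosed_closure hmaps, ?_⟩
  rw [MapsTo.restrict_surjective_iff]
  have himage := hf.2.1.closure_image_subset (f ⁻¹' C)
  rwa [image_preimage_eq C hfs] at himage

/-- The perfect continuous image of a `𝒫`-connected space is `𝒫`-connected. -/
theorem pConnected_of_perfect_image
    (P : (Y : Type u) → [TopologicalSpace Y] → Prop)
    (hP : ClosedHereditary P)
    (hinv : ∀ (Z W : Type u) [TopologicalSpace Z] [TopologicalSpace W] (g : Z → W),
      IsPerfectMap g → Function.Surjective g → P Z → P W)
    (hinvinv : ∀ (Z W : Type u) [TopologicalSpace Z] [TopologicalSpace W] (g : Z → W),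
      IsPerfectMap g → Function.Surjective g → P W → P Z)
    (X Y : Type u) [TopologicalSpace X] [TopologicalSpace Y]
    (f : X → Y) (hf : IsPerfectMap f) (hfs : Function.Surjective f)
    (hX : PConnected P X) :
    PConnected P Y := by
  rintro ⟨C, D, hC, hD, hCD, hPC, hPD, E, hE, hPE, hsub⟩
  obtain ⟨gC, hgC, hgCs⟩ := hf.exists_closure_preimage hfs C
  obtain ⟨gD, hgD, hgDs⟩ := hf.exists_closure_preimage hfs D
  obtain ⟨gE, hgE, hgEs⟩ := hf.exists_closure_preimage hfs E
  exact hX ⟨f ⁻¹' C, f ⁻¹' D, hC.preimage hf.1, hD.preimage hf.1, hCD.preimage f,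
    fun h => hPC (hinv _ _ gC hgC hgCs h), fun h => hPD (hinv _ _ gD hgD hgDs h),
    f ⁻¹' E, hE.preimage hf.1, hinvinv _ _ gE hgE hgEs hPE, preimage_mono hsub⟩
end

section
/- Let X be a Tychonoff space and let U be an open subset of X. Then cl_βX U ⊆ υX if and only if cl_X U (with the subspace topology) is pseudocompact. -/
open Set Topology
open scoped unitInterval

universe u

/-- A real function on `X`, continuous on the closure of an open set `U` and unbounded above on it,
gives rise to a nonnegative continuous function on all of `X` that is unbounded on `U`. -/
theorem exists_continuous_nonneg_unbounded_on_isOpen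
    {X : Type u} [TopologicalSpace X] [CompletelyRegularSpace X] {U : Set X} (hU : IsOpen U)
    {G : X → ℝ} (hG : ContinuousOn G (closure U)) (hub : ∀ M : ℝ, ∃ x ∈ closure U, M < G x) :
    ∃ h : X → ℝ, Continuous h ∧ (∀ x, 0 ≤ h x) ∧ ∀ n : ℕ, ∃ x ∈ U, (n : ℝ) ≤ h x := by
  have hubU (n : ℕ) : ∃ x ∈ U, (n : ℝ) < G x := by
    by_contra! hle
    obtain ⟨x, hx, hlt⟩ := hub n
    have hmem : G x ∈ closure (G '' U) := hG.image_closure (mem_image_of_mem G hx)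
    have hsub : closure (G '' U) ⊆ Iic (n : ℝ) :=
      closure_minimal (image_subset_iff.2 hle) isClosed_Iic
    exact absurd (hsub hmem) (not_le.2 hlt)
  choose x hxU hxG using hubU
  let V (n : ℕ) : Set X := U ∩ G ⁻¹' Ioi (n : ℝ)
  have hV (n : ℕ) : IsOpen (V n) :=
    (hG.mono subset_closure).isOpen_inter_preimage hU isOpen_Ioi
  have hVfin : LocallyFinite V := by
    intro y
    by_cases hy : y ∈ closure U
    · obtain ⟨N, hN⟩ := exists_nat_gt (G y)
      have hlt : ∀ᶠ z in 𝓝 y, z ∈ closure U → G z < N :=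
        eventually_nhdsWithin_iff.1 ((hG y hy).eventually_lt_const hN)
      refine ⟨_, hlt, (finite_lt_nat N).subset ?_⟩
      rintro n ⟨z, ⟨hzU, hzn⟩, hz⟩
      exact Nat.cast_lt.1 (lt_trans (show (n : ℝ) < G z from hzn) (hz (subset_closure hzU)))
    · refine ⟨(closure U)ᶜ, isClosed_closure.isOpen_compl.mem_nhds hy, finite_empty.subset ?_⟩
      rintro n ⟨z, ⟨hzU, -⟩, hz⟩
      exact hz (subset_closure hzU)
  choose f hf hf0 hf1 using fun n ↦ CompletelyRegularSpace.completely_regular_isOpen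
    (x n) (V n) (hV n) ⟨hxU n, hxG n⟩
  let φ (n : ℕ) (z : X) : ℝ := n * (1 - f n z)
  have hφ (n : ℕ) : Continuous (φ n) := by
    have := hf n
    fun_prop
  have hφ0 (n : ℕ) (z : X) : 0 ≤ φ n z :=
    mul_nonneg n.cast_nonneg (sub_nonneg.2 (f n z).2.2)
  have hsupp : LocallyFinite fun n ↦ Function.support (φ n) := by
    refine hVfin.subset fun n z hz ↦ ?_
    by_contra hzV
    exact hz (by simp [φ, hf1 n hzV])
  refine ⟨fun z ↦ ∑ᶠ n, φ n z, continuous_finsum hφ hsupp,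
    fun z ↦ finsum_nonneg fun n ↦ hφ0 n z, fun n ↦ ⟨x n, hxU n, ?_⟩⟩
  calc (n : ℝ) = φ n (x n) := by simp [φ, hf0 n]
    _ ≤ ∑ᶠ m, φ m (x n) :=
      single_le_finsum n (hsupp.point_finite (x n)) fun m ↦ hφ0 m (x n)

/-- If the closure of `A` in `βX` lies in `υX`, every nonnegative continuous function on `X` is
bounded on `A`. -/
theorem exists_forall_lt_of_closure_subset_upsilonSet
    {X : Type u} [TopologicalSpace X] {A : Set X}
    (hA : closure (stoneCechUnit '' A) ⊆ upsilonSet X)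
    {h : X → ℝ} (hc : Continuous h) (h0 : ∀ x, 0 ≤ h x) :
    ∃ n : ℕ, ∀ x ∈ A, h x < n := by
  by_contra! hub
  have hpos (x : X) : 0 < 1 + h x := by linarith [h0 x]
  let k (x : X) : I := ⟨(1 + h x)⁻¹, (inv_pos.2 (hpos x)).le,
    inv_le_one_of_one_le₀ (by linarith [h0 x])⟩
  have hk : Continuous k :=
    ((continuous_const.add hc).inv₀ fun x ↦ (hpos x).ne').subtype_mk _
  have hne : (closure (stoneCechUnit '' A)).Nonempty := by
    obtain ⟨x, hx, -⟩ := hub 0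
    exact ⟨_, subset_closure (mem_image_of_mem _ hx)⟩
  obtain ⟨p, hp, hmin⟩ := isClosed_closure.isCompact.exists_isMinOn hne
    (continuous_stoneCechExtend hk).continuousOn
  have hp0 : stoneCechExtend hk p = 0 := by
    by_contra hpne
    have hppos : (0 : ℝ) < (stoneCechExtend hk p : I) := unitInterval.pos_iff_ne_zero.2 hpne
    obtain ⟨n, hn⟩ := exists_nat_gt ((stoneCechExtend hk p : I) : ℝ)⁻¹
    obtain ⟨x, hx, hnx⟩ := hub n
    have hle : stoneCechExtend hk p ≤ k x := by
      rw [← stoneCechExtend_stoneCechUnit hk x]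
      exact hmin (subset_closure (mem_image_of_mem _ hx))
    have hle' : ((stoneCechExtend hk p : I) : ℝ) ≤ (1 + h x)⁻¹ := hle
    have := (le_inv_comm₀ hppos (hpos x)).1 hle'
    linarith
  obtain ⟨_, hq, x, rfl⟩ :=
    hA hp _ ⟨stoneCechExtend hk, continuous_stoneCechExtend hk, rfl⟩ hp0
  have hkx : k x = 0 := (stoneCechExtend_stoneCechUnit hk x).symm.trans hq
  exact (inv_pos.2 (hpos x)).ne' (congrArg Subtype.val hkx)

theorem closure_subset_upsilonSet_of_pseudocompact
    {X : Type u} [TopologicalSpace X] {A : Set X} (hA : Pseudocompact ↥(closure A)) :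
    closure (stoneCechUnit '' A) ⊆ upsilonSet X := by
  rintro p hp _ ⟨f, hf, rfl⟩ hfp
  by_contra hdisj
  have hpos (x : X) : (0 : ℝ) < f (stoneCechUnit x) :=
    unitInterval.pos_iff_ne_zero.2 fun hx ↦ hdisj ⟨_, hx, x, rfl⟩
  obtain ⟨M, hM⟩ := hA (fun x ↦ (f (stoneCechUnit (x : X)) : ℝ)⁻¹)
    ((continuous_subtype_val.comp (hf.comp
      (continuous_stoneCechUnit.comp continuous_subtype_val))).inv₀ fun x ↦ (hpos x).ne')
  have hsub : closure (stoneCechUnit '' A) ⊆ {q | 1 ≤ M * (f q : ℝ)} := by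
    refine closure_minimal ?_ (isClosed_le continuous_const (by fun_prop))
    rintro _ ⟨x, hx, rfl⟩
    have hle := (le_abs_self _).trans (hM ⟨x, subset_closure hx⟩)
    exact (inv_le_iff_one_le_mul₀ (hpos x)).1 hle
  have h1 : 1 ≤ M * (f p : ℝ) := hsub hp
  rw [show f p = 0 from hfp] at h1
  norm_num at h1

/-- For open `U ⊆ X`: `cl_βX U ⊆ υX` iff `cl_X U` is pseudocompact. -/
theorem stoneCechClosure_subset_upsilon_iff_pseudocompact
    (X : Type u) [TopologicalSpace X] [T35Space X]
    (U : Set X) (hU : IsOpen U) :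
    closure (stoneCechUnit '' U) ⊆ upsilonSet X ↔ Pseudocompact ↥(closure U) := by
  refine ⟨fun hsub g hg ↦ ?_, closure_subset_upsilonSet_of_pseudocompact⟩
  by_contra! hub
  let G : X → ℝ := Function.extend Subtype.val (fun y : closure U ↦ |g y|) 0
  have hGval (y : closure U) : G y = |g y| := Subtype.val_injective.extend_apply _ _ y
  have hG : ContinuousOn G (closure U) := by
    rw [continuousOn_iff_continuous_domRestrict]
    exact hg.abs.congr fun y ↦ (hGval y).symm
  obtain ⟨h, hc, h0, hunb⟩ := exists_continuous_nonneg_unbounded_on_isOpen hU hG fun M ↦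
    let ⟨y, hy⟩ := hub M
    ⟨y, y.2, hy.trans_eq (hGval y).symm⟩
  obtain ⟨n, hn⟩ := exists_forall_lt_of_closure_subset_upsilonSet hsub hc h0
  obtain ⟨x, hx, hnx⟩ := hunb n
  exact (hn x hx).not_ge hnx
end

section
/- Let X be a Tychonoff space and let 𝒫 be pseudocompactness. Then λ_𝒫X = int_βX(υX). -/
open Set Topology
open scoped unitInterval

universe u

/-- A subset of `X` is relatively pseudocompact if every continuous real-valued function on `X`
is bounded on it. -/
def RelativelyPseudocompact {X : Type u} [TopologicalSpace X] (S : Set X) : Prop :=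
  ∀ f : X → ℝ, Continuous f → ∃ M : ℝ, ∀ x ∈ S, |f x| ≤ M

theorem isCozeroSetIn_iff {X : Type u} [TopologicalSpace X] {C : Set X} :
    IsCozeroSetIn C ↔ ∃ f : X → I, Continuous f ∧ C = {x | 0 < f x} := by
  refine exists_congr fun f => and_congr_right fun _ => ?_
  rw [compl_eq_comm, eq_comm]
  have : (f ⁻¹' {0})ᶜ = {x | 0 < f x} := by
    ext x
    simp [unitInterval.pos_iff_ne_zero]
  rw [this]

/-- Relatively pseudocompact sets are those whose closure in `βX` lies in `υX`. -/
theorem relativelyPseudocompact_iff_closure_subset_upsilonSet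
    {X : Type u} [TopologicalSpace X] {S : Set X} :
    RelativelyPseudocompact S ↔ closure (stoneCechUnit '' S) ⊆ upsilonSet X := by
  constructor
  · rintro hS p hp _ ⟨f, hf, rfl⟩ hpf
    by_contra hne
    have hpos : ∀ x : X, (0 : ℝ) < f (stoneCechUnit x) := fun x =>
      unitInterval.coe_pos.2 <| unitInterval.pos_iff_ne_zero.2 fun h0 =>
        hne ⟨_, h0, mem_range_self x⟩
    obtain ⟨M, hM⟩ := hS (fun x => (f (stoneCechUnit x) : ℝ)⁻¹)
      ((continuous_subtype_val.comp (hf.comp continuous_stoneCechUnit)).inv₀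
        fun x => (hpos x).ne')
    have hclosed : IsClosed {q | 1 ≤ M * (f q : ℝ)} :=
      isClosed_le continuous_const (continuous_const.mul (continuous_subtype_val.comp hf))
    have hsub : stoneCechUnit '' S ⊆ {q | 1 ≤ M * (f q : ℝ)} := by
      rintro _ ⟨x, hx, rfl⟩
      have h := (le_abs_self _).trans (hM x hx)
      exact (inv_le_iff_one_le_mul₀ (hpos x)).1 h
    have h := closure_minimal hsub hclosed hp
    have hp0 : f p = 0 := hpf
    norm_num [hp0] at h
  · intro hS F hF
    have hmem : ∀ x, (1 + |F x|)⁻¹ ∈ I := fun x =>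
      ⟨by positivity, inv_le_one_of_one_le₀ (by linarith [abs_nonneg (F x)])⟩
    have hk : Continuous fun x => (⟨(1 + |F x|)⁻¹, hmem x⟩ : I) :=
      ((continuous_const.add hF.abs).inv₀ fun x => (by positivity : 1 + |F x| ≠ 0)).subtype_mk hmem
    set k := stoneCechExtend hk with hkdef
    have hkc : Continuous k := continuous_stoneCechExtend hk
    have hkX : ∀ x, (k (stoneCechUnit x) : ℝ) = (1 + |F x|)⁻¹ := fun x => by
      rw [hkdef, stoneCechExtend_stoneCechUnit]
    have hpos : ∀ q ∈ closure (stoneCechUnit '' S), (0 : ℝ) < k q := by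
      intro q hq
      refine unitInterval.coe_pos.2 (unitInterval.pos_iff_ne_zero.2 fun h0 => ?_)
      obtain ⟨_, hx0, x, rfl⟩ := hS hq _ ⟨k, hkc, rfl⟩ h0
      have hx0 : k (stoneCechUnit x) = 0 := hx0
      have h := hkX x
      rw [hx0] at h
      have : 0 < (1 + |F x|)⁻¹ := by positivity
      exact this.ne h
    obtain ⟨δ, hδ, hle⟩ := isClosed_closure.isCompact.exists_forall_le'
      (continuous_subtype_val.comp hkc).continuousOn hpos
    refine ⟨δ⁻¹, fun x hx => ?_⟩
    have h := hle _ (subset_closure (mem_image_of_mem stoneCechUnit hx))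
    simp only [Function.comp_apply, hkX] at h
    have := (le_inv_comm₀ hδ (by positivity)).1 h
    linarith

theorem exists_continuous_natCast_le (b : ℕ → ℝ) :
    ∃ ψ : C(ℝ, ℝ), ∀ (n : ℕ) (t : ℝ), n ≤ t → b n ≤ ψ t := by
  obtain ⟨ψ, hψ⟩ := exists_continuous_forall_mem_convex_of_local_const
    (t := fun t : ℝ => {y : ℝ | ∀ n : ℕ, (n : ℝ) ≤ t → b n ≤ y}) (fun t => by
      simp only [ofPred_forall]
      exact convex_iInter fun n => convex_iInter fun _ => convex_Ici _) (fun t => by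
      obtain ⟨N, hN⟩ := exists_nat_gt t
      obtain ⟨c, hc⟩ := ((Set.finite_Iio N).image b).bddAbove
      refine ⟨c, Filter.mem_of_superset (Iio_mem_nhds hN) fun s hs n hn => ?_⟩
      exact hc ⟨n, by exact_mod_cast hn.trans_lt hs, rfl⟩)
  exact ⟨ψ, fun n t h => hψ t n h⟩

theorem RelativelyPseudocompact.of_pseudocompact_closure {X : Type u} [TopologicalSpace X]
    {S : Set X} (hS : Pseudocompact (closure S)) : RelativelyPseudocompact S := fun f hf => by
  obtain ⟨M, hM⟩ := hS (fun x => f x) (hf.comp continuous_subtype_val)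
  exact ⟨M, fun x hx => hM ⟨x, subset_closure hx⟩⟩

theorem RelativelyPseudocompact.pseudocompact_closure {X : Type u} [TopologicalSpace X]
    {C : Set X} (hC : IsCozeroSetIn C) (hrel : RelativelyPseudocompact C) :
    Pseudocompact (closure C) := by
  classical
  obtain ⟨g, hg, rfl⟩ := isCozeroSetIn_iff.1 hC
  set C := {x | 0 < g x}
  intro h hh
  by_contra! hunb
  have hlarge : ∀ n : ℕ, ∃ x, ∃ hx : x ∈ C, (n : ℝ) ≤ |h ⟨x, subset_closure hx⟩| := by
    intro n
    by_contra! hlt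
    obtain ⟨y, hy⟩ := hunb n
    have hd : Dense {y : closure C | (y : X) ∈ C} := by
      rw [Subtype.dense_iff]
      intro x hx
      convert hx
      ext z
      simpa using fun hz => subset_closure hz
    have hcl : IsClosed {y : closure C | |h y| ≤ n} := isClosed_le hh.abs continuous_const
    have hall := closure_minimal (fun (z : closure C) hz => (hlt z hz).le) hcl (hd y)
    exact hy.not_ge hall
  choose x hxC hx using hlarge
  obtain ⟨ψ, hψ⟩ := exists_continuous_natCast_le fun n => n / (g (x n) : ℝ)
  let F : X → ℝ := fun z => if hz : z ∈ closure C then g z * ψ |h ⟨z, hz⟩| else 0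
  have hF : Continuous F := by
    have hcover : closure C ∪ {z | g z = 0} = univ := by
      refine eq_univ_of_forall fun z => ?_
      by_cases hz : g z = 0
      · exact Or.inr hz
      · exact Or.inl (subset_closure (unitInterval.pos_iff_ne_zero.2 hz))
    rw [← continuousOn_univ, ← hcover]
    refine ContinuousOn.union_of_isClosed ?_ ?_ isClosed_closure
      (isClosed_eq hg continuous_const)
    · rw [continuousOn_iff_continuous_domRestrict]
      have heq : (closure C).domRestrict F = fun z : closure C => (g z : ℝ) * ψ |h z| := by
        ext z
        simp [F]
      rw [heq]
      fun_prop
    · refine continuousOn_const (c := (0 : ℝ)) |>.congr fun z hz => ?_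
      have hz : g z = 0 := hz
      simp [F, hz]
  obtain ⟨M, hM⟩ := hrel F hF
  obtain ⟨n, hn⟩ := exists_nat_gt M
  have hgpos : (0 : ℝ) < g (x n) := unitInterval.coe_pos.2 (hxC n)
  have hFx : F (x n) = g (x n) * ψ |h ⟨x n, subset_closure (hxC n)⟩| :=
    dif_pos (subset_closure (hxC n))
  have hle : (n : ℝ) ≤ F (x n) := by
    rw [hFx, ← div_le_iff₀' hgpos]
    exact hψ n _ (hx n)
  linarith [le_abs_self (F (x n)), hM _ (hxC n)]

/-- The closures in `βX` of cozero-sets of `X` form a neighbourhood basis at each point, among those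
which are neighbourhoods of that point. -/
theorem exists_isCozeroSetIn_mem_interior_closure {X : Type u} [TopologicalSpace X]
    {U : Set (StoneCech X)} (hU : IsOpen U) {p : StoneCech X} (hp : p ∈ U) :
    ∃ C : Set X, IsCozeroSetIn C ∧ p ∈ interior (closure (stoneCechUnit '' C)) ∧
      closure (stoneCechUnit '' C) ⊆ U := by
  obtain ⟨V, hV, hVc, hVU⟩ := exists_mem_nhds_isClosed_subset (hU.mem_nhds hp)
  obtain ⟨f, hf, hfp, hfV⟩ := CompletelyRegularSpace.completely_regular p (interior V)ᶜ
    isOpen_interior.isClosed_compl (by simpa [mem_interior_iff_mem_nhds] using hV)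
  have hW : IsOpen {q | f q < 1} := isOpen_lt hf continuous_const
  have himage : stoneCechUnit '' (stoneCechUnit ⁻¹' {q | f q < 1} : Set X) ⊆ V := by
    rintro _ ⟨x, hx, rfl⟩
    by_contra hxV
    exact hx.ne (hfV fun h => hxV (interior_subset h))
  refine ⟨stoneCechUnit ⁻¹' {q | f q < 1}, isCozeroSetIn_iff.2
    ⟨fun x => unitInterval.symm (f (stoneCechUnit x)),
      unitInterval.continuous_symm.comp (hf.comp continuous_stoneCechUnit), ?_⟩,
    mem_interior.2 ⟨_, ?_, hW, ?_⟩, (closure_minimal himage hVc).trans hVU⟩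
  · ext x
    simp [unitInterval.pos_iff_ne_zero, unitInterval.lt_one_iff_ne_one]
  · rw [image_preimage_eq_inter_range]
    exact denseRange_stoneCechUnit.open_subset_closure_inter hW
  · simp [hfp]

/-- With `𝒫` = pseudocompactness, `λ_𝒫X = int_βX (υX)`. -/
theorem lambdaSet_pseudocompact_eq_interior_upsilon
    (X : Type u) [TopologicalSpace X] [T35Space X] :
    lambdaSet (fun Y _ => Pseudocompact Y) X = interior (upsilonSet X) := by
  apply Subset.antisymm
  · refine iUnion₂_subset fun C hC => interior_mono ?_
    exact relativelyPseudocompact_iff_closure_subset_upsilonSet.1 (.of_pseudocompact_closure hC.2)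
  · intro p hp
    obtain ⟨C, hC, hpC, hCU⟩ := exists_isCozeroSetIn_mem_interior_closure isOpen_interior hp
    have hrel := relativelyPseudocompact_iff_closure_subset_upsilonSet.2
      (hCU.trans interior_subset)
    exact mem_biUnion (show C ∈ {C : Set X | _} from ⟨hC, hrel.pseudocompact_closure hC⟩) hpC
end

section
/- Let X be a Tychonoff space and let 𝒫 be pseudocompactness. Then X is 𝒫-connected if and only if cl_βX(βX \ υX) is a preconnected subset of βX. -/
open Set Topology
open scoped unitInterval

universe u

theorem exists_pos_iff_mem_of_isCozeroSetIn {X : Type u} [TopologicalSpace X] {C : Set X}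
    (hC : IsCozeroSetIn C) :
    ∃ f : X → ℝ, Continuous f ∧ (∀ x, 0 ≤ f x) ∧ ∀ x, x ∈ C ↔ 0 < f x := by
  obtain ⟨f, hf, hfC⟩ := hC
  refine ⟨fun x => f x, by fun_prop, fun x => (f x).2.1, fun x => ?_⟩
  have h : x ∈ Cᶜ ↔ f x = 0 := by rw [hfC]; simp
  have h2 : (f x : ℝ) = 0 ↔ f x = 0 := by
    rw [← Set.Icc.coe_zero, Subtype.coe_inj]
  rw [← not_iff_not, ← mem_compl_iff, h, ← h2, not_lt]
  exact ⟨fun h => h.le, fun h => le_antisymm h (f x).2.1⟩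

theorem isZeroSetIn_nonpos {X : Type u} [TopologicalSpace X] {g : X → ℝ}
    (hg : Continuous g) : IsZeroSetIn {x | g x ≤ 0} := by
  refine ⟨fun x => projIcc 0 1 zero_le_one (g x), continuous_projIcc.comp hg, ?_⟩
  ext x
  simp

theorem isCozeroSetIn_pos {X : Type u} [TopologicalSpace X] {g : X → ℝ}
    (hg : Continuous g) : IsCozeroSetIn {x | 0 < g x} := by
  have h : {x | 0 < g x}ᶜ = {x | g x ≤ 0} := by ext x; simp
  rw [IsCozeroSetIn, h]
  exact isZeroSetIn_nonpos hg

/-- A continuous function into `[0,1]` extends to the Stone–Čech compactification. -/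
theorem exists_stoneCech_extension {X : Type u} [TopologicalSpace X] {g : X → ℝ}
    (hg : Continuous g) (h0 : ∀ x, 0 ≤ g x) (h1 : ∀ x, g x ≤ 1) :
    ∃ G : StoneCech X → ℝ, Continuous G ∧ ∀ x, G (stoneCechUnit x) = g x := by
  have hc : Continuous (fun x => (⟨g x, h0 x, h1 x⟩ : I)) := hg.subtype_mk _
  refine ⟨fun p => (stoneCechExtend hc p : I),
    continuous_subtype_val.comp (continuous_stoneCechExtend hc), fun x => ?_⟩
  change (((stoneCechExtend hc ∘ stoneCechUnit) x : I) : ℝ) = g x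
  rw [stoneCechExtend_extends]

theorem notMem_upsilonSet_iff {X : Type u} [TopologicalSpace X] {p : StoneCech X} :
    p ∉ upsilonSet X ↔ ∃ F : StoneCech X → ℝ, Continuous F ∧ F p ≤ 0 ∧
      ∀ x : X, 0 < F (stoneCechUnit x) := by
  constructor
  · intro h
    simp only [upsilonSet, mem_ofPred_eq, not_forall] at h
    obtain ⟨Z, hZ, hp, hne⟩ := h
    obtain ⟨F, hF, h0, hmem⟩ := exists_pos_iff_mem_of_isCozeroSetIn (C := Zᶜ)
      (by rwa [IsCozeroSetIn, compl_compl])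
    refine ⟨F, hF, not_lt.1 fun h => (hmem p).2 h hp, fun x => (hmem _).1 fun hx => hne ?_⟩
    exact ⟨_, hx, mem_range_self x⟩
  · rintro ⟨F, hF, hp, hpos⟩ h
    obtain ⟨_, hq, x, rfl⟩ := h _ (isZeroSetIn_nonpos hF) hp
    exact absurd (hpos x) (not_lt.2 hq)

/-- A continuous real function dominating prescribed values: `k t ≥ c n` once `|t| ≥ n`. -/
theorem exists_continuous_dominating (c : ℕ → ℝ) :
    ∃ k : ℝ → ℝ, Continuous k ∧ ∀ (n : ℕ) (t : ℝ), (n : ℝ) ≤ |t| → c n ≤ k t := by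
  obtain ⟨k, hk⟩ := exists_continuous_forall_mem_convex_of_local_const
    (t := fun t : ℝ => {y : ℝ | ∀ n : ℕ, (n : ℝ) ≤ |t| → c n ≤ y})
    (fun t y hy z hz a b ha hb hab n hn => by
      have h1 := mul_le_mul_of_nonneg_left (hy n hn) ha
      have h2 := mul_le_mul_of_nonneg_left (hz n hn) hb
      calc c n = a * c n + b * c n := by rw [← add_mul, hab, one_mul]
        _ ≤ a * y + b * z := add_le_add h1 h2)
    (fun t => by
      obtain ⟨N, hN⟩ := exists_nat_gt |t|
      refine ⟨∑ i ∈ Finset.range N, |c i|, ?_⟩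
      filter_upwards [(continuous_abs.tendsto t).eventually (gt_mem_nhds hN)] with s hs n hn
      have hnN : n < N := by exact_mod_cast hn.trans_lt hs
      exact (le_abs_self _).trans
        (Finset.single_le_sum (f := fun i => |c i|) (fun i _ => abs_nonneg _)
          (Finset.mem_range.2 hnN)))
  exact ⟨k, k.continuous, fun n t h => hk t n h⟩

/-- If the closure of a cozero-set is not pseudocompact, some continuous function on the whole
space is unbounded on the cozero-set. -/
theorem exists_continuous_unbounded {X : Type u} [TopologicalSpace X] {C : Set X}
    (hC : IsCozeroSetIn C) (h : ¬ Pseudocompact ↥(closure C)) :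
    ∃ f : X → ℝ, Continuous f ∧ ∀ n : ℕ, ∃ x ∈ C, (n : ℝ) ≤ |f x| := by
  obtain ⟨e, he, he0, heC⟩ := exists_pos_iff_mem_of_isCozeroSetIn hC
  simp only [Pseudocompact, not_forall, not_exists, not_le] at h
  obtain ⟨g, hg, hunb⟩ := h
  have hex : ∀ n : ℕ, ∃ x, ∃ hx : x ∈ C, (n : ℝ) ≤ |g ⟨x, subset_closure hx⟩| := by
    intro n
    obtain ⟨y, hy⟩ := hunb n
    have hopen : IsOpen {y | (n : ℝ) < |g y|} := isOpen_lt continuous_const hg.abs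
    obtain ⟨V, hV, hVeq⟩ := isOpen_induced_iff.1 hopen
    have hyV : (y : X) ∈ V := by
      change y ∈ Subtype.val ⁻¹' V
      rw [hVeq]; exact hy
    obtain ⟨x, hxV, hxC⟩ := mem_closure_iff.1 y.2 V hV hyV
    refine ⟨x, hxC, ?_⟩
    have : (⟨x, subset_closure hxC⟩ : closure C) ∈ Subtype.val ⁻¹' V := hxV
    rw [hVeq] at this
    exact this.le
  choose x hx hgx using hex
  obtain ⟨k, hk, hkc⟩ := exists_continuous_dominating fun n => n / e (x n)
  classical
  let f : X → ℝ := fun y => if hy : y ∈ closure C then e y * k (g ⟨y, hy⟩) else 0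
  have hfC : ContinuousOn f (closure C) := by
    rw [continuousOn_iff_continuous_domRestrict]
    have : (closure C).domRestrict f = fun y : closure C => e y * k (g y) := by
      ext y; simp [f]
    rw [this]
    fun_prop
  have hfC' : ContinuousOn f Cᶜ := by
    refine (continuousOn_const (c := (0 : ℝ))).congr fun y hy => ?_
    have : e y = 0 := le_antisymm (not_lt.1 fun h => hy ((heC y).2 h)) (he0 y)
    simp [f, this]
  have hCo : IsOpen C := by
    have : C = {y | 0 < e y} := by ext y; exact heC y
    rw [this]; exact isOpen_lt continuous_const he
  refine ⟨f, ?_, fun n => ⟨x n, hx n, ?_⟩⟩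
  · rw [← continuousOn_univ]
    have := hfC.union_of_isClosed hfC' isClosed_closure hCo.isClosed_compl
    refine this.mono fun y _ => ?_
    by_cases hy : y ∈ C
    · exact Or.inl (subset_closure hy)
    · exact Or.inr hy
  · have hpos := (heC _).1 (hx n)
    have h1 := hkc n _ (hgx n)
    rw [div_le_iff₀ hpos] at h1
    have h2 : f (x n) = e (x n) * k (g ⟨x n, subset_closure (hx n)⟩) := by
      simp [f, subset_closure (hx n)]
    rw [h2, mul_comm]
    exact h1.trans (le_abs_self _)

theorem pseudocompact_closure_iff {X : Type u} [TopologicalSpace X] {C : Set X}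
    (hC : IsCozeroSetIn C) :
    Pseudocompact ↥(closure C) ↔ closure (stoneCechUnit '' C) ⊆ upsilonSet X := by
  constructor
  · intro h p hp
    by_contra hpu
    obtain ⟨F, hF, hFp, hpos⟩ := notMem_upsilonSet_iff.1 hpu
    obtain ⟨M, hM⟩ := h (fun y => (F (stoneCechUnit (y : X)))⁻¹)
      (Continuous.inv₀ (hF.comp (continuous_stoneCechUnit.comp continuous_subtype_val))
        fun y => (hpos y).ne')
    have hsub : closure (stoneCechUnit '' C) ⊆ {q | 1 ≤ |M| * F q} := by
      refine closure_minimal ?_ (isClosed_le continuous_const (by fun_prop))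
      rintro _ ⟨y, hy, rfl⟩
      have h1 := ((le_abs_self _).trans (hM ⟨y, subset_closure hy⟩)).trans (le_abs_self M)
      exact (inv_le_iff_one_le_mul₀ (hpos y)).1 h1
    have h1 : 1 ≤ |M| * F p := hsub hp
    nlinarith [abs_nonneg M]
  · intro h
    by_contra hps
    obtain ⟨f, hf, hunb⟩ := exists_continuous_unbounded hC hps
    have hpos : ∀ x, 0 < 1 + |f x| := fun x => by positivity
    obtain ⟨F, hF, hFf⟩ := exists_stoneCech_extension (g := fun x => (1 + |f x|)⁻¹)
      (Continuous.inv₀ (by fun_prop) fun x => (hpos x).ne')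
      (fun x => (inv_pos.2 (hpos x)).le)
      (fun x => inv_le_one_of_one_le₀ (by linarith [abs_nonneg (f x)]))
    obtain ⟨x₀, hx₀, -⟩ := hunb 0
    obtain ⟨p, hp, hmin⟩ := (isClosed_closure (s := stoneCechUnit '' C)).isCompact.exists_isMinOn
      ⟨_, subset_closure (mem_image_of_mem _ hx₀)⟩ hF.continuousOn
    refine notMem_upsilonSet_iff.2 ⟨F, hF, ?_, fun x => ?_⟩ (h hp)
    · by_contra! hlt
      obtain ⟨n, hn⟩ := exists_nat_gt (F p)⁻¹
      obtain ⟨x, hx, hnx⟩ := hunb n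
      have h1 : F p ≤ F (stoneCechUnit x) := hmin (subset_closure (mem_image_of_mem _ hx))
      rw [hFf, le_inv_comm₀ hlt (hpos x)] at h1
      linarith
    · rw [hFf]; exact inv_pos.2 (hpos x)

theorem not_isPreconnected_of_isPSeparation {X : Type u} [TopologicalSpace X] {C D : Set X}
    (h : IsPSeparation (fun Y _ => Pseudocompact Y) C D) :
    ¬ IsPreconnected (closure ((upsilonSet X)ᶜ)) := by
  obtain ⟨hC, hD, hdisj, hnC, hnD, E, hE, hPE, hsub⟩ := h
  replace hnC := not_subset.1 (mt (pseudocompact_closure_iff hC).2 hnC)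
  replace hnD := not_subset.1 (mt (pseudocompact_closure_iff hD).2 hnD)
  replace hPE := (pseudocompact_closure_iff hE).1 hPE
  obtain ⟨p, hpC, hp⟩ := hnC
  obtain ⟨q, hqD, hq⟩ := hnD
  obtain ⟨c, hc, hc0, hcC⟩ := exists_pos_iff_mem_of_isCozeroSetIn hC
  obtain ⟨d, hd, hd0, hdD⟩ := exists_pos_iff_mem_of_isCozeroSetIn hD
  obtain ⟨e, he, he0, heE⟩ := exists_pos_iff_mem_of_isCozeroSetIn hE
  have hpos : ∀ x, 0 < c x + d x + e x := by
    intro x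
    have := hc0 x; have := hd0 x; have := he0 x
    by_cases hx : x ∈ C ∪ D
    · rcases hx with hx | hx
      · linarith [(hcC x).1 hx]
      · linarith [(hdD x).1 hx]
    · linarith [(heE x).1 (hsub hx)]
  have hcd : ∀ x, c x * d x = 0 := by
    intro x
    by_contra hne
    have h1 := (hc0 x).lt_of_ne' (left_ne_zero_of_mul hne)
    have h2 := (hd0 x).lt_of_ne' (right_ne_zero_of_mul hne)
    exact disjoint_left.1 hdisj ((hcC x).2 h1) ((hdD x).2 h2)
  have hs : Continuous fun x => c x + d x + e x := by fun_prop
  obtain ⟨u, hu, huc⟩ := exists_stoneCech_extension (g := fun x => c x / (c x + d x + e x))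
    (hc.div hs fun x => (hpos x).ne') (fun x => div_nonneg (hc0 x) (hpos x).le)
    (fun x => (div_le_one (hpos x)).2 (by linarith [hd0 x, he0 x]))
  obtain ⟨v, hv, hvd⟩ := exists_stoneCech_extension (g := fun x => d x / (c x + d x + e x))
    (hd.div hs fun x => (hpos x).ne') (fun x => div_nonneg (hd0 x) (hpos x).le)
    (fun x => (div_le_one (hpos x)).2 (by linarith [hc0 x, he0 x]))
  have huv : ∀ r, u r * v r = 0 := by
    intro r
    refine congrFun (denseRange_stoneCechUnit.equalizer (hu.mul hv) continuous_const ?_) r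
    funext x
    simp [huc, hvd, div_mul_div_comm, hcd]
  have hK : ∀ r ∈ closure ((upsilonSet X)ᶜ), 1 ≤ u r + v r := by
    refine closure_minimal (fun r hr => ?_) (isClosed_le continuous_const (hu.add hv))
    by_contra hlt
    replace hlt : u r + v r < 1 := not_le.1 hlt
    refine hr (hPE (mem_closure_iff.2 fun O hO hrO => ?_))
    obtain ⟨x, hxO, hx⟩ := denseRange_stoneCechUnit.exists_mem_open
      (hO.inter (isOpen_lt (hu.add hv) continuous_const)) ⟨r, hrO, hlt⟩
    refine ⟨_, hxO, mem_image_of_mem _ ((heE x).2 ?_)⟩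
    rw [mem_ofPred_eq, Pi.add_apply, huc, hvd, ← add_div, div_lt_one (hpos x)] at hx
    linarith
  have hsep : ∀ w z : StoneCech X → ℝ, Continuous z → (∀ r, w r * z r = 0) →
      (∀ r ∈ closure ((upsilonSet X)ᶜ), 1 ≤ w r + z r) → ∀ S : Set X,
      (∀ x ∈ S, 0 < w (stoneCechUnit x)) → ∀ r ∈ closure ((upsilonSet X)ᶜ),
      r ∈ closure (stoneCechUnit '' S) → 0 < w r := by
    intro w z hz hwz hK S hS r hrK hrS
    by_contra hle
    have hzr : 0 < z r := by linarith [hK r hrK]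
    obtain ⟨_, hzx, x, hx, rfl⟩ := mem_closure_iff.1 hrS _ (isOpen_lt continuous_const hz) hzr
    exact (mul_pos (hS x hx) hzx).ne' (hwz _)
  have hup : 0 < u p := hsep u v hv huv hK C
    (fun x hx => by rw [huc]; exact div_pos ((hcC x).1 hx) (hpos x)) p (subset_closure hp) hpC
  have hvq : 0 < v q := hsep v u hu (fun r => by rw [mul_comm, huv])
    (fun r hr => by rw [add_comm]; exact hK r hr) D
    (fun x hx => by rw [hvd]; exact div_pos ((hdD x).1 hx) (hpos x)) q (subset_closure hq) hqD
  intro hpre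
  obtain ⟨r, -, h1, h2⟩ := hpre {r | 0 < u r} {r | 0 < v r}
    (isOpen_lt continuous_const hu) (isOpen_lt continuous_const hv)
    (fun r hr => by
      by_contra hn
      simp only [mem_union, mem_ofPred_eq, not_or, not_lt] at hn
      linarith [hK r hr])
    ⟨p, subset_closure hp, hup⟩ ⟨q, subset_closure hq, hvq⟩
  exact (mul_pos h1 h2).ne' (huv r)

theorem exists_isPSeparation_of_not_isPreconnected {X : Type u} [TopologicalSpace X]
    (h : ¬ IsPreconnected (closure ((upsilonSet X)ᶜ))) :
    ∃ C D : Set X, IsPSeparation (fun Y _ => Pseudocompact Y) C D := by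
  rw [isPreconnected_iff_subset_of_fully_disjoint_closed isClosed_closure] at h
  push Not at h
  obtain ⟨A, B, hA, hB, hAB, hdisj, hnA, hnB⟩ := h
  obtain ⟨f, hfA, hfB, -⟩ := exists_continuous_zero_one_of_isClosed hA hB hdisj
  have hcoz : ∀ g : StoneCech X → ℝ, Continuous g →
      IsCozeroSetIn {x : X | 0 < g (stoneCechUnit x)} :=
    fun g hg => isCozeroSetIn_pos (hg.comp continuous_stoneCechUnit)
  have key : ∀ g : StoneCech X → ℝ, Continuous g → ∀ p ∈ closure ((upsilonSet X)ᶜ), 0 < g p →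
      ¬ Pseudocompact ↥(closure {x : X | 0 < g (stoneCechUnit x)}) := by
    intro g hg p hp hgp hps
    replace hps := (pseudocompact_closure_iff (hcoz g hg)).1 hps
    obtain ⟨q, hq, hqu⟩ := mem_closure_iff.1 hp _ (isOpen_lt continuous_const hg) hgp
    refine hqu (hps (mem_closure_iff.2 fun O hO hqO => ?_))
    obtain ⟨x, hxO, hx⟩ := denseRange_stoneCechUnit.exists_mem_open
      (hO.inter (isOpen_lt continuous_const hg)) ⟨q, hqO, hq⟩
    exact ⟨_, hxO, mem_image_of_mem _ hx⟩
  obtain ⟨a, haK, haA⟩ := not_subset.1 hnA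
  obtain ⟨b, hbK, hbB⟩ := not_subset.1 hnB
  have ha : f a = 1 := hfB ((hAB haK).resolve_left haA)
  have hb : f b = 0 := hfA ((hAB hbK).resolve_right hbB)
  refine ⟨{x | 0 < 1 / 2 - f (stoneCechUnit x)}, {x | 0 < f (stoneCechUnit x) - 1 / 2},
    hcoz (fun r => 1 / 2 - f r) (by fun_prop), hcoz (fun r => f r - 1 / 2) (by fun_prop),
    disjoint_left.2 fun x h1 h2 => ?_,
    key (fun r => 1 / 2 - f r) (by fun_prop) b hbK (by norm_num [hb]),
    key (fun r => f r - 1 / 2) (by fun_prop) a haK (by norm_num [ha]),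
    {x | 0 < 1 / 4 - |f (stoneCechUnit x) - 1 / 2|},
    hcoz (fun r => 1 / 4 - |f r - 1 / 2|) (by fun_prop), ?_, ?_⟩
  · simp only [mem_ofPred_eq] at h1 h2
    linarith
  · refine (pseudocompact_closure_iff
      (hcoz (fun r => 1 / 4 - |f r - 1 / 2|) (by fun_prop))).2 ?_
    have hsub : closure (stoneCechUnit '' {x : X | 0 < 1 / 4 - |f (stoneCechUnit x) - 1 / 2|}) ⊆
        {r | 0 ≤ 1 / 4 - |f r - 1 / 2|} := by
      refine closure_minimal ?_ (isClosed_le continuous_const (by fun_prop))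
      rintro _ ⟨x, hx, rfl⟩
      exact LT.lt.le (b := 1 / 4 - |f (stoneCechUnit x) - 1 / 2|) hx
    intro r hr
    by_contra hru
    have h1 : 0 ≤ 1 / 4 - |f r - 1 / 2| := hsub hr
    rcases hAB (subset_closure hru) with h | h
    · have h2 : f r = 0 := hfA h
      norm_num [h2, abs_of_pos] at h1
    · have h2 : f r = 1 := hfB h
      norm_num [h2, abs_of_pos] at h1
  · intro x hx
    simp only [mem_compl_iff, mem_union, mem_ofPred_eq, not_or, not_lt] at hx ⊢
    have : f (stoneCechUnit x) = 1 / 2 := by linarith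
    norm_num [this]

/-- With `𝒫` = pseudocompactness, `X` is `𝒫`-connected iff `cl_βX (βX \ υX)` is
preconnected. -/
theorem pseudocompact_connected_iff_isPreconnected_closure_compl_upsilon
    (X : Type u) [TopologicalSpace X] [T35Space X] :
    PConnected (fun Y _ => Pseudocompact Y) X ↔
      IsPreconnected (closure ((upsilonSet X)ᶜ)) := by
  rw [PConnected, not_iff_comm]
  exact ⟨exists_isPSeparation_of_not_isPreconnected,
    fun ⟨_, _, h⟩ => not_isPreconnected_of_isPSeparation h⟩
end

section
/- Let X be a Tychonoff space that is 𝒫-connected, where 𝒫 is pseudocompactness, and let f : X → Y be a perfect, open, continuous surjection onto a topological space Y. Then Y is 𝒫-connected (with 𝒫 pseudocompactness). -/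
open Set Topology
open scoped unitInterval

universe u

theorem Pseudocompact.of_surjective {X Y : Type u} [TopologicalSpace X] [TopologicalSpace Y]
    {f : X → Y} (hf : Continuous f) (hfs : Function.Surjective f) (hX : Pseudocompact X) :
    Pseudocompact Y := by
  intro g hg
  obtain ⟨M, hM⟩ := hX (g ∘ f) (hg.comp hf)
  exact ⟨M, hfs.forall.2 hM⟩

/-- The fiberwise maximum of a continuous real function along a perfect open surjection
is continuous. -/
theorem IsPerfectMap.exists_continuous_fiberwise_max {X Y : Type u} [TopologicalSpace X]
    [TopologicalSpace Y] {f : X → Y} (hf : IsPerfectMap f) (hfo : IsOpenMap f)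
    (hfs : Function.Surjective f) {g : X → ℝ} (hg : Continuous g) :
    ∃ h : Y → ℝ, Continuous h ∧ ∀ x, g x ≤ h (f x) := by
  have hmax : ∀ y, ∃ x, f x = y ∧ ∀ x', f x' = y → g x' ≤ g x := fun y ↦
    (hf.2.2 y).exists_isMaxOn (hfs y) hg.continuousOn
  choose s hs hsmax using hmax
  refine ⟨g ∘ s, ?_, fun x ↦ hsmax _ x rfl⟩
  refine continuous_iff_lower_upperSemicontinuous.2
    ⟨lowerSemicontinuous_iff_isOpen_preimage.2 fun a ↦ ?_,
      upperSemicontinuous_iff_isOpen_preimage.2 fun a ↦ ?_⟩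
  · convert hfo _ (isOpen_Ioi.preimage hg : IsOpen (g ⁻¹' Ioi a)) using 1
    ext y
    constructor
    · exact fun hy ↦ ⟨s y, hy, hs y⟩
    · rintro ⟨x, hx, rfl⟩
      exact lt_of_lt_of_le hx (hsmax _ x rfl)
  · convert (hf.2.1 _ (isClosed_Ici.preimage hg : IsClosed (g ⁻¹' Ici a))).isOpen_compl using 1
    ext y
    constructor
    · rintro hy ⟨x, hx, rfl⟩
      exact absurd hy (not_lt.2 (le_trans hx (hsmax _ x rfl)))
    · intro hy
      exact lt_of_not_ge fun hle : a ≤ g (s y) ↦ hy ⟨s y, hle, hs y⟩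

theorem Pseudocompact.of_perfect_open {X Y : Type u} [TopologicalSpace X] [TopologicalSpace Y]
    {f : X → Y} (hf : IsPerfectMap f) (hfo : IsOpenMap f) (hfs : Function.Surjective f)
    (hY : Pseudocompact Y) : Pseudocompact X := by
  intro g hg
  obtain ⟨h, hh, hle⟩ := hf.exists_continuous_fiberwise_max hfo hfs hg.abs
  obtain ⟨M, hM⟩ := hY h hh
  exact ⟨M, fun x ↦ (hle x).trans ((le_abs_self _).trans (hM _))⟩

theorem IsPerfectMap.restrictPreimage {X Y : Type u} [TopologicalSpace X] [TopologicalSpace Y]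
    {f : X → Y} (hf : IsPerfectMap f) (B : Set Y) : IsPerfectMap (B.restrictPreimage f) := by
  refine ⟨hf.1.restrictPreimage, hf.2.1.restrictPreimage B, fun y ↦ ?_⟩
  rw [IsEmbedding.subtypeVal.isCompact_iff]
  convert hf.2.2 y using 1
  ext x
  constructor
  · rintro ⟨x, hx, rfl⟩
    exact congrArg Subtype.val hx
  · intro hx
    have hxB : f x ∈ B := by
      rw [show f x = y from hx]
      exact y.2
    exact ⟨⟨x, hxB⟩, Subtype.ext hx, rfl⟩

theorem pseudocompact_closure_preimage_iff {X Y : Type u} [TopologicalSpace X]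
    [TopologicalSpace Y] {f : X → Y} (hf : IsPerfectMap f) (hfo : IsOpenMap f)
    (hfs : Function.Surjective f) (C : Set Y) :
    Pseudocompact ↥(closure (f ⁻¹' C)) ↔ Pseudocompact ↥(closure C) := by
  rw [← hfo.preimage_closure_eq_closure_preimage hf.1]
  exact ⟨.of_surjective hf.1.restrictPreimage (hfs.restrictPreimage _),
    .of_perfect_open (hf.restrictPreimage _) (hfo.restrictPreimage _) (hfs.restrictPreimage _)⟩

/-- Every perfect open continuous image of a Tychonoff pseudocompactness-connected
space is pseudocompactness-connected. -/
theorem pseudocompact_connected_of_perfect_open_image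
    (X Y : Type u) [TopologicalSpace X] [T35Space X] [TopologicalSpace Y]
    (f : X → Y) (hf : IsPerfectMap f) (hfo : IsOpenMap f) (hfs : Function.Surjective f)
    (hX : PConnected (fun Z _ => Pseudocompact Z) X) :
    PConnected (fun Z _ => Pseudocompact Z) Y := by
  rintro ⟨C, D, hC, hD, hCD, hCP, hDP, E, hE, hEP, hsub⟩
  have hiff := pseudocompact_closure_preimage_iff hf hfo hfs
  exact hX ⟨f ⁻¹' C, f ⁻¹' D, hC.preimage hf.1, hD.preimage hf.1, hCD.preimage f,
    fun h ↦ hCP ((hiff C).1 h), fun h ↦ hDP ((hiff D).1 h),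
    f ⁻¹' E, hE.preimage hf.1, (hiff E).2 hEP, preimage_mono hsub⟩
end
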